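/- arXiv:1401.6255 — 7 statements merged into one kernel-verified Lean document; each statement's English description precedes it below -/
import Mathlib

section
/- Let d ≥ 1, let A = (a_ij) be a d×d symmetric positive definite real matrix, and let R = (r_ij) be a d×d real matrix with all diagonal entries equal to 1. Let A^{1/2} be the unique symmetric positive definite square root of A and A^{-1/2} its inverse. For i = 1,…,d define n_i := a_ii^{-1/2} A^{1/2} e_i, v_i := a_ii^{1/2} A^{-1/2} R e_i, and q_i := v_i − n_i. Let D := diag(a_11,…,a_dd). Then the skew-symmetry condition in the orthant form, R D + D Rᵀ = 2A (equivalently, r_ij a_jj + r_ji a_ii = 2 a_ij for all i, j), holds if and only if the skew-symmetry condition in the polyhedral form holds: n_i · q_j + n_j · q_i = 0 for all i, j = 1,…,d. -/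
open Matrix

theorem Matrix.IsSymm.mulVec_single_one_dotProduct {d : ℕ} {B : Matrix (Fin d) (Fin d) ℝ}
    (hB : B.IsSymm) (i : Fin d) (w : Fin d → ℝ) :
    (B *ᵥ Pi.single i 1) ⬝ᵥ w = (B *ᵥ w) i := by
  rw [← single_one_dotProduct i (B *ᵥ w), dotProduct_mulVec, ← mulVec_transpose, hB.eq]

/-- Equivalence of the two forms of the skew-symmetry condition: the orthant form
`R D + D Rᵀ = 2 A` holds iff the polyhedral form `n i · q j + n j · q i = 0` holds,
where `n i = a_ii^{-1/2} A^{1/2} e_i`, `v i = a_ii^{1/2} A^{-1/2} R e_i`, `q i = v i - n i`. -/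
theorem stmt_5 (d : ℕ) (hd : 1 ≤ d)
    (A R B : Matrix (Fin d) (Fin d) ℝ)
    (hA : A.PosDef) (hR : ∀ i, R i i = 1)
    (hB : B.PosDef) (hBA : B * B = A)
    (n v q : Fin d → (Fin d → ℝ))
    (hn : ∀ i, n i = (Real.sqrt (A i i))⁻¹ • (B *ᵥ Pi.single i 1))
    (hv : ∀ i, v i = Real.sqrt (A i i) • (B⁻¹ *ᵥ (R *ᵥ Pi.single i 1)))
    (hq : ∀ i, q i = v i - n i)
    (D : Matrix (Fin d) (Fin d) ℝ) (hD : D = Matrix.diagonal (fun i => A i i)) :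
    (R * D + D * Rᵀ = 2 • A) ↔ (∀ i j, n i ⬝ᵥ q j + n j ⬝ᵥ q i = 0) := by
  have hBs : B.IsSymm := by simpa using hB.isHermitian
  have hAs : A.IsSymm := by simpa using hA.isHermitian
  have hBdet : IsUnit B.det := (isUnit_iff_isUnit_det B).mp hB.isUnit
  have hpos : ∀ i, 0 < √(A i i) := fun i => Real.sqrt_pos.mpr hA.diag_pos
  have hsq : ∀ i, √(A i i) ^ 2 = A i i := fun i => Real.sq_sqrt hA.diag_pos.le
  have hnn : ∀ i j, n i ⬝ᵥ n j = (√(A i i))⁻¹ * (√(A j j))⁻¹ * A i j := by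
    intro i j
    rw [hn, hn, smul_dotProduct, dotProduct_smul, hBs.mulVec_single_one_dotProduct,
      mulVec_mulVec, hBA, mulVec_single_one, smul_eq_mul, smul_eq_mul, mul_assoc, col_apply]
  have hnv : ∀ i j, n i ⬝ᵥ v j = (√(A i i))⁻¹ * √(A j j) * R i j := by
    intro i j
    rw [hn, hv, smul_dotProduct, dotProduct_smul, hBs.mulVec_single_one_dotProduct,
      mulVec_mulVec, mul_nonsing_inv _ hBdet, one_mulVec, mulVec_single_one, smul_eq_mul,
      smul_eq_mul, mul_assoc, col_apply]
  have hsum : ∀ i j, n i ⬝ᵥ q j + n j ⬝ᵥ q i =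
      (R i j * A j j + A i i * R j i - 2 * A i j) / (√(A i i) * √(A j j)) := by
    intro i j
    have hi := (hpos i).ne'
    have hj := (hpos j).ne'
    rw [hq, hq, dotProduct_sub, dotProduct_sub, hnn, hnn, hnv, hnv, hAs.apply i j,
      eq_div_iff (mul_ne_zero hi hj)]
    field_simp
    rw [hsq, hsq]
    ring
  rw [← Matrix.ext_iff]
  refine forall₂_congr fun i j => ?_
  rw [hsum, div_eq_zero_iff, or_iff_left (mul_pos (hpos i) (hpos j)).ne', sub_eq_zero, hD]
  simp
end

section
/- Let d ≥ 1, let A = (a_ij) be a d×d symmetric positive definite real matrix, and let R = (r_ij) be a d×d completely-S matrix with all diagonal entries equal to 1. Let A^{1/2} be the unique symmetric positive definite square root of A and A^{-1/2} its inverse. For i = 1,…,d define n_i := a_ii^{-1/2} A^{1/2} e_i and v_i := a_ii^{1/2} A^{-1/2} R e_i. Then for every nonempty subset I ⊆ {1,…,d} there exist real coefficients α_j > 0, j ∈ I, such that the vector n := Σ_{j ∈ I} α_j n_j satisfies v_i · n > 0 for every i ∈ I. -/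
open Matrix

/-- If `a + ε * b ≥ 0` for every `ε > 0`, then `a ≥ 0`. -/
theorem nonneg_of_forall_pos_add_mul_nonneg {a b : ℝ} (h : ∀ ε : ℝ, 0 < ε → 0 ≤ a + ε * b) :
    0 ≤ a := by
  by_contra! ha
  have hb : 0 < |b| + 1 := by positivity
  have h1 := h (-a / (2 * (|b| + 1))) (by apply div_pos <;> linarith)
  have h2 : -a / (2 * (|b| + 1)) * b ≤ -a / (2 * (|b| + 1)) * (|b| + 1) :=
    mul_le_mul_of_nonneg_left (by linarith [le_abs_self b]) (by apply div_nonneg <;> linarith)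
  have h3 : -a / (2 * (|b| + 1)) * (|b| + 1) = -a / 2 := by field_simp
  linarith

/-- Ville's theorem of the alternative: if no positive vector `u` satisfies `u ᵥ* M > 0`, then
some nonzero `y ≥ 0` satisfies `M *ᵥ y ≤ 0`. -/
theorem exists_nonneg_mulVec_nonpos {ι : Type*} [Fintype ι] [DecidableEq ι] (M : Matrix ι ι ℝ)
    (hM : ¬ ∃ u : ι → ℝ, (∀ i, 0 < u i) ∧ ∀ i, 0 < (u ᵥ* M) i) :
    ∃ y : ι → ℝ, (∀ i, 0 ≤ y i) ∧ y ≠ 0 ∧ ∀ i, (M *ᵥ y) i ≤ 0 := by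
  set s : Set (ι → ℝ) := {a | ∀ i, 0 < a i} with hs
  have hs_eq : s = Set.pi Set.univ fun _ => Set.Ioi 0 := by ext; simp [hs]
  have hs_open : IsOpen s := hs_eq ▸ isOpen_set_pi Set.finite_univ fun _ _ => isOpen_Ioi
  have hs_conv : Convex ℝ s := hs_eq ▸ convex_pi fun _ _ => convex_Ioi 0
  have hdisj : Disjoint s (M.vecMulLinear '' s) := by
    rw [Set.disjoint_left]
    rintro _ ha ⟨u, hu, rfl⟩
    exact hM ⟨u, hu, ha⟩
  obtain ⟨f, c, hfs, hft⟩ :=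
    geometric_hahn_banach_open hs_conv hs_open (hs_conv.linear_image M.vecMulLinear) hdisj
  have hft' : ∀ u : ι → ℝ, (∀ i, 0 < u i) → c ≤ f (u ᵥ* M) := fun u hu => hft _ ⟨u, hu, rfl⟩
  have hc : 0 ≤ c := nonneg_of_forall_pos_add_mul_nonneg (b := -f 1) fun ε hε => by
    have := hfs (ε • (1 : ι → ℝ)) fun i => by simpa using hε
    rw [map_smul, smul_eq_mul] at this
    linarith
  have hf_sum : ∀ a : ι → ℝ, f a = ∑ i, a i * f (Pi.single i 1) := fun a => by
    conv_lhs => rw [pi_eq_sum_univ' a]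
    simp [map_sum]
  refine ⟨fun i => -f (Pi.single i 1), fun k => ?_, fun hy => ?_, fun k => ?_⟩
  · by_contra! hk
    have hk' : 0 < f (Pi.single k 1) := by linarith
    have := hfs (1 + (|c - f 1| / f (Pi.single k 1)) • Pi.single k 1) fun i => by
      have : 0 ≤ (Pi.single k 1 : ι → ℝ) i := by
        by_cases h : i = k
        · subst h; simp
        · simp [h]
      simp only [Pi.add_apply, Pi.one_apply, Pi.smul_apply, smul_eq_mul]
      positivity
    rw [map_add, map_smul, smul_eq_mul, div_mul_cancel₀ _ hk'.ne'] at this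
    linarith [le_abs_self (c - f 1)]
  · have hf0 : ∀ a, f a = 0 := fun a => by
      rw [hf_sum]
      exact Finset.sum_eq_zero fun i _ => by
        rw [neg_eq_zero.mp (congrFun hy i), mul_zero]
    have h1 := hfs 1 fun _ => one_pos
    have h2 := hft' 1 fun _ => one_pos
    rw [hf0] at h1 h2
    linarith
  · have hrow : 0 ≤ f (Pi.single k 1 ᵥ* M) :=
      nonneg_of_forall_pos_add_mul_nonneg (b := f (1 ᵥ* M)) fun ε hε => by
        have := hft' (Pi.single k 1 + ε • 1) fun i => by
          by_cases h : i = k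
          · subst h; simp; linarith
          · simp [h, hε]
        rw [add_vecMul, smul_vecMul, map_add, map_smul, smul_eq_mul] at this
        linarith
    rw [hf_sum] at hrow
    simpa [mulVec, dotProduct] using hrow

/-- If `R` is completely-`S`, then no principal submatrix of `R` maps a
positive vector to a nonpositive one. -/
theorem exists_pos_sum_of_completelyS {ι : Type*} (R : Matrix ι ι ℝ)
    (hR : ∀ I : Finset ι, I.Nonempty →
      ∃ u : ι → ℝ, (∀ i ∈ I, 0 < u i) ∧ (∀ i ∈ I, 0 < ∑ j ∈ I, R i j * u j))
    (J : Finset ι) (hJ : J.Nonempty) (y : ι → ℝ) (hy : ∀ i ∈ J, 0 < y i) :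
    ∃ i ∈ J, 0 < ∑ j ∈ J, R i j * y j := by
  induction J using Finset.strongInduction generalizing y with
  | H J ih =>
    by_contra! hneg
    obtain ⟨u, hu, hRu⟩ := hR J hJ
    obtain ⟨k, hkJ, hk⟩ := J.exists_min_image (fun i => y i / u i) hJ
    set t := y k / u k with ht
    have ht_pos : 0 < t := div_pos (hy k hkJ) (hu k hkJ)
    set w : ι → ℝ := fun i => y i - t * u i with hw
    have hw_nonneg : ∀ i ∈ J, 0 ≤ w i := fun i hi =>
      sub_nonneg.mpr ((le_div_iff₀ (hu i hi)).mp (hk i hi))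
    have hwk : w k = 0 := by simp [hw, ht, (hu k hkJ).ne']
    have hRw : ∀ i ∈ J, ∑ j ∈ J, R i j * w j < 0 := fun i hi => by
      have : ∑ j ∈ J, R i j * w j = ∑ j ∈ J, R i j * y j - t * ∑ j ∈ J, R i j * u j := by
        rw [Finset.mul_sum, ← Finset.sum_sub_distrib]
        exact Finset.sum_congr rfl fun j _ => by simp only [hw]; ring
      rw [this]
      linarith [hneg i hi, mul_pos ht_pos (hRu i hi)]
    have hsum : ∀ i, ∑ j ∈ J with 0 < w j, R i j * w j = ∑ j ∈ J, R i j * w j := fun i =>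
      Finset.sum_filter_of_ne fun j hj hne =>
        (hw_nonneg j hj).lt_of_ne' (right_ne_zero_of_mul hne)
    rcases (J.filter fun i => 0 < w i).eq_empty_or_nonempty with hK | hK
    · have := hRw k hkJ
      rw [← hsum, hK, Finset.sum_empty] at this
      exact this.false
    · obtain ⟨i, hi, hpos⟩ := ih _
        (Finset.filter_ssubset.mpr ⟨k, hkJ, by simp [hwk]⟩) hK w
        fun i hi => (Finset.mem_filter.mp hi).2
      rw [hsum] at hpos
      exact hpos.not_gt (hRw i (Finset.mem_filter.mp hi).1)

/-- The transpose of a completely-`S` matrix is completely-`S`. -/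
theorem completelyS_transpose {ι : Type*} [DecidableEq ι] (R : Matrix ι ι ℝ)
    (hR : ∀ I : Finset ι, I.Nonempty →
      ∃ u : ι → ℝ, (∀ i ∈ I, 0 < u i) ∧ (∀ i ∈ I, 0 < ∑ j ∈ I, R i j * u j))
    (I : Finset ι) :
    ∃ u : ι → ℝ, (∀ i ∈ I, 0 < u i) ∧ (∀ i ∈ I, 0 < ∑ j ∈ I, u j * R j i) := by
  by_cases hM : ∃ u : I → ℝ, (∀ i, 0 < u i) ∧
      ∀ i, 0 < (u ᵥ* R.submatrix (Subtype.val : I → ι) (Subtype.val : I → ι)) i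
  · obtain ⟨u, hu, huR⟩ := hM
    refine ⟨fun i => if h : i ∈ I then u ⟨i, h⟩ else 0, fun i hi => by simpa [hi] using hu ⟨i, hi⟩,
      fun i hi => ?_⟩
    rw [← Finset.sum_coe_sort]
    simpa [vecMul, dotProduct] using huR ⟨i, hi⟩
  · obtain ⟨y, hy, hy0, hRy⟩ := exists_nonneg_mulVec_nonpos _ hM
    exfalso
    set z : ι → ℝ := fun i => if h : i ∈ I then y ⟨i, h⟩ else 0 with hz
    have hzI : ∀ i : I, z i = y i := fun i => by simp [hz]
    have hRz : ∀ i ∈ I, ∑ j ∈ I, R i j * z j ≤ 0 := fun i hi => by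
      rw [← Finset.sum_coe_sort]
      simpa [mulVec, dotProduct, hzI] using hRy ⟨i, hi⟩
    have hsupp : (I.filter fun i => 0 < z i).Nonempty := by
      obtain ⟨i, hi⟩ := Function.ne_iff.mp hy0
      exact ⟨i, Finset.mem_filter.mpr ⟨i.2, by rw [hzI]; exact (hy i).lt_of_ne' hi⟩⟩
    obtain ⟨i, hi, hpos⟩ := exists_pos_sum_of_completelyS R hR _ hsupp z
      fun i hi => (Finset.mem_filter.mp hi).2
    rw [Finset.sum_filter_of_ne fun j hj hne =>
      (by simpa [hz, hj] using hy ⟨j, hj⟩ : 0 ≤ z j).lt_of_ne' (right_ne_zero_of_mul hne)] at hpos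
    exact hpos.not_ge (hRz i (Finset.mem_filter.mp hi).1)

/-- If `R` is completely-S with unit diagonal, then for every nonempty index set `I` there are
positive coefficients `α j`, `j ∈ I`, such that `n := ∑_{j ∈ I} α j • n j` satisfies
`v i · n > 0` for all `i ∈ I`, where `n i = a_ii^{-1/2} A^{1/2} e_i` and
`v i = a_ii^{1/2} A^{-1/2} R e_i`. -/
theorem stmt_6 (d : ℕ) (hd : 1 ≤ d)
    (A R B : Matrix (Fin d) (Fin d) ℝ)
    (hA : A.PosDef) (hRdiag : ∀ i, R i i = 1)
    (hRS : ∀ I : Finset (Fin d), I.Nonempty →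
      ∃ u : Fin d → ℝ, (∀ i ∈ I, 0 < u i) ∧ (∀ i ∈ I, 0 < ∑ j ∈ I, R i j * u j))
    (hB : B.PosDef) (hBA : B * B = A)
    (n v : Fin d → (Fin d → ℝ))
    (hn : ∀ i, n i = (Real.sqrt (A i i))⁻¹ • (B *ᵥ Pi.single i 1))
    (hv : ∀ i, v i = Real.sqrt (A i i) • (B⁻¹ *ᵥ (R *ᵥ Pi.single i 1))) :
    ∀ I : Finset (Fin d), I.Nonempty →
      ∃ α : Fin d → ℝ, (∀ j ∈ I, 0 < α j) ∧
        (∀ i ∈ I, 0 < v i ⬝ᵥ (∑ j ∈ I, α j • n j)) := by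
  intro I _
  obtain ⟨u, hu, huR⟩ := completelyS_transpose R hRS I
  have hsqrt : ∀ i, 0 < √(A i i) := fun i => Real.sqrt_pos.mpr hA.diag_pos
  have hvn : ∀ i j, v i ⬝ᵥ n j = √(A i i) * (√(A j j))⁻¹ * R j i := fun i j => by
    have hBT : Bᵀ = B := by simpa using hB.isHermitian.eq
    have hdot : (B⁻¹ *ᵥ (R *ᵥ Pi.single i 1)) ⬝ᵥ (B *ᵥ Pi.single j 1) = R j i := by
      rw [dotProduct_mulVec, ← mulVec_transpose, hBT, mulVec_mulVec,
        mul_nonsing_inv _ ((isUnit_iff_isUnit_det B).mp hB.isUnit), one_mulVec]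
      simp
    rw [hv, hn, smul_dotProduct, dotProduct_smul, hdot, smul_eq_mul, smul_eq_mul, mul_assoc]
  refine ⟨fun j => √(A j j) * u j, fun j hj => mul_pos (hsqrt j) (hu j hj), fun i hi => ?_⟩
  have : v i ⬝ᵥ (∑ j ∈ I, (√(A j j) * u j) • n j) = √(A i i) * ∑ j ∈ I, u j * R j i := by
    rw [dotProduct_sum, Finset.mul_sum]
    refine Finset.sum_congr rfl fun j _ => ?_
    rw [dotProduct_smul, hvn, smul_eq_mul]
    field_simp [(hsqrt j).ne']
  rw [this]
  exact mul_pos (hsqrt i) (huR i hi)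
end

section
/- Let A = (a_ij) be a 2×2 symmetric positive definite real matrix and let r_{12}, r_{21} ∈ ℝ. Then (a_{11} r_{21} − a_{12}) / (a_{11} (a_{11} r_{21}² − 2 a_{12} r_{21} + a_{22}))^{1/2} + (a_{22} r_{12} − a_{12}) / (a_{22} (a_{22} r_{12}² − 2 a_{12} r_{12} + a_{11}))^{1/2} < 0 if and only if r_{12} a_{22} + r_{21} a_{11} < 2 a_{12}. (Since A is positive definite, both denominators are strictly positive.) -/
open Matrix

/-- The function `x ↦ x / √(x² + d)` is strictly increasing for `d > 0`. -/
theorem strictMono_div_sqrt_sq_add {d : ℝ} (hd : 0 < d) :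
    StrictMono fun x : ℝ => x / Real.sqrt (x ^ 2 + d) := by
  refine strictMono_of_odd_strictMonoOn_nonneg (fun x => by simp [neg_div]) ?_
  intro x hx y _ hxy
  have hx : 0 ≤ x := hx
  have hy : 0 ≤ y := hx.trans hxy.le
  have hsq : x ^ 2 < y ^ 2 := by gcongr
  change x / Real.sqrt (x ^ 2 + d) < y / Real.sqrt (y ^ 2 + d)
  rw [div_lt_div_iff₀ (by positivity) (by positivity)]
  refine lt_of_pow_lt_pow_left₀ 2 (by positivity) ?_
  rw [mul_pow, mul_pow, Real.sq_sqrt (by positivity), Real.sq_sqrt (by positivity)]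
  nlinarith

/-- For a 2×2 symmetric positive definite matrix `A` and reals `r₁₂, r₂₁`:
the sum of the two sines of reflection angles is negative iff
`r₁₂ a₂₂ + r₂₁ a₁₁ < 2 a₁₂`. -/
theorem stmt_9 (A : Matrix (Fin 2) (Fin 2) ℝ) (hA : A.PosDef) (r12 r21 : ℝ) :
    ((A 0 0 * r21 - A 0 1) /
        Real.sqrt (A 0 0 * (A 0 0 * r21 ^ 2 - 2 * A 0 1 * r21 + A 1 1)) +
     (A 1 1 * r12 - A 0 1) /
        Real.sqrt (A 1 1 * (A 1 1 * r12 ^ 2 - 2 * A 0 1 * r12 + A 0 0)) < 0)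
    ↔ r12 * A 1 1 + r21 * A 0 0 < 2 * A 0 1 := by
  have hsymm : A 1 0 = A 0 1 := by simpa using hA.isHermitian.apply 0 1
  have hdet : 0 < A 0 0 * A 1 1 - A 0 1 ^ 2 := by
    simpa [Matrix.det_fin_two, hsymm, sq] using hA.det_pos
  have h := (strictMono_div_sqrt_sq_add hdet).lt_iff_lt
    (a := A 0 0 * r21 - A 0 1) (b := -(A 1 1 * r12 - A 0 1))
  simp only [neg_sq, neg_div] at h
  rw [show A 0 0 * (A 0 0 * r21 ^ 2 - 2 * A 0 1 * r21 + A 1 1) =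
      (A 0 0 * r21 - A 0 1) ^ 2 + (A 0 0 * A 1 1 - A 0 1 ^ 2) by ring,
    show A 1 1 * (A 1 1 * r12 ^ 2 - 2 * A 0 1 * r12 + A 0 0) =
      (A 1 1 * r12 - A 0 1) ^ 2 + (A 0 0 * A 1 1 - A 0 1 ^ 2) by ring,
    ← lt_neg_iff_add_neg, h]
  constructor <;> intro <;> linarith
end

section
/- Let N ≥ 3. Let σ_1,…,σ_N be positive real numbers and let q⁻_1, q⁺_1, …, q⁻_N, q⁺_N be real numbers with 0 < q^±_k < 1 for all k and q⁺_{k+1} + q⁻_k = 1 for k = 1,…,N−1. Define the (N−1)×(N−1) real matrices R and A by: R_{kk} = 1, R_{k,k+1} = −q⁻_{k+1}, R_{k+1,k} = −q⁺_{k+1}, and R_{kl} = 0 for |k−l| ≥ 2; A_{kk} = σ_k² + σ_{k+1}², A_{k,k+1} = A_{k+1,k} = −σ_{k+1}², and A_{kl} = 0 for |k−l| ≥ 2 (indices k, l ∈ {1,…,N−1}). Then the condition R_{ij} A_{jj} + R_{ji} A_{ii} ≥ 2 A_{ij} holds for all i, j ∈ {1,…,N−1} if and only if (q⁻_{k−1}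 + q⁺_{k+1}) σ_k² ≥ q⁻_k σ_{k+1}² + q⁺_k σ_{k−1}² for all k = 2,…,N−1. -/
open Matrix

/-- For the gap process of `N` competing Brownian particles with asymmetric collisions,
with reflection matrix `R` and covariance matrix `A` as in the paper, the condition
`R_{ij} A_{jj} + R_{ji} A_{ii} ≥ 2 A_{ij}` for all `i, j` is equivalent to
`(q⁻_{k-1} + q⁺_{k+1}) σ_k² ≥ q⁻_k σ_{k+1}² + q⁺_k σ_{k-1}²` for `k = 2, …, N-1`.
Here matrix indices `i : Fin (N-1)` correspond to the 1-based index `i.val + 1`. -/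
theorem stmt_11 (N : ℕ) (hN : 3 ≤ N)
    (σ qm qp : ℕ → ℝ)
    (hσ : ∀ k, 1 ≤ k → k ≤ N → 0 < σ k)
    (hq : ∀ k, 1 ≤ k → k ≤ N → 0 < qm k ∧ qm k < 1 ∧ 0 < qp k ∧ qp k < 1)
    (hsum : ∀ k, 1 ≤ k → k ≤ N - 1 → qp (k + 1) + qm k = 1)
    (R A : Matrix (Fin (N - 1)) (Fin (N - 1)) ℝ)
    (hRdiag : ∀ k, R k k = 1)
    (hRsub : ∀ k l : Fin (N - 1), l.val = k.val + 1 →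
      R k l = - qm (k.val + 2) ∧ R l k = - qp (k.val + 2))
    (hRzero : ∀ k l : Fin (N - 1), k.val + 2 ≤ l.val ∨ l.val + 2 ≤ k.val → R k l = 0)
    (hAdiag : ∀ k : Fin (N - 1), A k k = σ (k.val + 1) ^ 2 + σ (k.val + 2) ^ 2)
    (hAsub : ∀ k l : Fin (N - 1), l.val = k.val + 1 →
      A k l = - σ (k.val + 2) ^ 2 ∧ A l k = - σ (k.val + 2) ^ 2)
    (hAzero : ∀ k l : Fin (N - 1), k.val + 2 ≤ l.val ∨ l.val + 2 ≤ k.val → A k l = 0) :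
    (∀ i j : Fin (N - 1), R i j * A j j + R j i * A i i ≥ 2 * A i j) ↔
    (∀ k, 2 ≤ k → k ≤ N - 1 →
      (qm (k - 1) + qp (k + 1)) * σ k ^ 2 ≥ qm k * σ (k + 1) ^ 2 + qp k * σ (k - 1) ^ 2) := by
  have adjacent_iff : ∀ k l : Fin (N - 1), l.val = k.val + 1 →
      (R k l * A l l + R l k * A k k ≥ 2 * A k l ↔
        (qm (k.val + 1) + qp (k.val + 3)) * σ (k.val + 2) ^ 2 ≥
          qm (k.val + 2) * σ (k.val + 3) ^ 2 + qp (k.val + 2) * σ (k.val + 1) ^ 2) := by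
    intro k l hkl
    have hl := l.isLt
    have hleft : qm (k.val + 1) = 1 - qp (k.val + 2) := by
      linarith [hsum (k.val + 1) (by omega) (by omega)]
    have hright : qp (k.val + 3) = 1 - qm (k.val + 2) := by
      linarith [hsum (k.val + 2) (by omega) (by omega)]
    rw [(hRsub k l hkl).1, (hRsub k l hkl).2, (hAsub k l hkl).1, hAdiag k, hAdiag l, hkl,
      hleft, hright]
    constructor <;> intro h <;> linarith
  constructor
  · intro h k hk hkN
    obtain ⟨m, rfl⟩ := Nat.exists_eq_add_of_le' hk
    exact (adjacent_iff ⟨m, by omega⟩ ⟨m + 1, by omega⟩ rfl).1 (h _ _)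
  · intro h
    have adjacent : ∀ k l : Fin (N - 1), l.val = k.val + 1 →
        R k l * A l l + R l k * A k k ≥ 2 * A k l := fun k l hkl =>
      (adjacent_iff k l hkl).2 (h (k.val + 2) (by omega) (by omega))
    intro i j
    obtain hij | hij | hij | hij : i = j ∨ j.val = i.val + 1 ∨ i.val = j.val + 1 ∨
        (i.val + 2 ≤ j.val ∨ j.val + 2 ≤ i.val) := by omega
    · subst hij
      rw [hRdiag]
      linarith
    · exact adjacent i j hij
    · have hji := adjacent j i hij
      rw [(hAsub j i hij).1] at hji
      rw [(hAsub j i hij).2]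
      linarith
    · rw [hRzero i j hij, hRzero j i hij.symm, hAzero i j hij]
      simp
end

section
/- Let N ≥ 3 and let σ_1,…,σ_N be positive real numbers. Define the (N−1)×(N−1) real matrices R and A by: R_{kk} = 1, R_{k,k+1} = R_{k+1,k} = −1/2, and R_{kl} = 0 for |k−l| ≥ 2; A_{kk} = σ_k² + σ_{k+1}², A_{k,k+1} = A_{k+1,k} = −σ_{k+1}², and A_{kl} = 0 for |k−l| ≥ 2 (indices k, l ∈ {1,…,N−1}). Then the condition R_{ij} A_{jj} + R_{ji} A_{ii} ≥ 2 A_{ij} holds for all i, j ∈ {1,…,N−1} if and only if the sequence (σ_n²)_{1 ≤ n ≤ N} is concave, that is, σ_{k+1}² − σ_k² ≤ σ_k² − σ_{k−1}² for all k = 2,…,N−1. -/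
open Matrix

/-- For the gap process of a classical system of `N` competing Brownian particles
(reflection matrix `R` with off-diagonal entries `-1/2` on the sub/superdiagonal,
covariance matrix `A` as in the paper), the condition
`R_{ij} A_{jj} + R_{ji} A_{ii} ≥ 2 A_{ij}` for all `i, j` is equivalent to concavity
of the sequence `(σ_n²)`: `σ_{k+1}² - σ_k² ≤ σ_k² - σ_{k-1}²` for `k = 2, …, N-1`.
Here matrix indices `i : Fin (N-1)` correspond to the 1-based index `i.val + 1`. -/
theorem stmt_12 (N : ℕ) (hN : 3 ≤ N)
    (σ : ℕ → ℝ)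
    (hσ : ∀ k, 1 ≤ k → k ≤ N → 0 < σ k)
    (R A : Matrix (Fin (N - 1)) (Fin (N - 1)) ℝ)
    (hRdiag : ∀ k, R k k = 1)
    (hRsub : ∀ k l : Fin (N - 1), l.val = k.val + 1 →
      R k l = - (1 / 2 : ℝ) ∧ R l k = - (1 / 2 : ℝ))
    (hRzero : ∀ k l : Fin (N - 1), k.val + 2 ≤ l.val ∨ l.val + 2 ≤ k.val → R k l = 0)
    (hAdiag : ∀ k : Fin (N - 1), A k k = σ (k.val + 1) ^ 2 + σ (k.val + 2) ^ 2)
    (hAsub : ∀ k l : Fin (N - 1), l.val = k.val + 1 →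
      A k l = - σ (k.val + 2) ^ 2 ∧ A l k = - σ (k.val + 2) ^ 2)
    (hAzero : ∀ k l : Fin (N - 1), k.val + 2 ≤ l.val ∨ l.val + 2 ≤ k.val → A k l = 0) :
    (∀ i j : Fin (N - 1), R i j * A j j + R j i * A i i ≥ 2 * A i j) ↔
    (∀ k, 2 ≤ k → k ≤ N - 1 →
      σ (k + 1) ^ 2 - σ k ^ 2 ≤ σ k ^ 2 - σ (k - 1) ^ 2) := by
  constructor
  · intro h k hk2 hkN
    obtain ⟨m, rfl⟩ : ∃ m, k = m + 2 := ⟨k - 2, by omega⟩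
    let i : Fin (N - 1) := ⟨m, by omega⟩
    let j : Fin (N - 1) := ⟨m + 1, by omega⟩
    have hij := h i j
    rw [(hRsub i j rfl).1, (hRsub i j rfl).2, (hAsub i j rfl).1, hAdiag i, hAdiag j] at hij
    simp only [i, j, show m + 1 + 1 = m + 2 from rfl, show m + 1 + 2 = m + 3 from rfl] at hij
    simp only [show m + 2 + 1 = m + 3 from rfl, show m + 2 - 1 = m + 1 from rfl]
    linarith
  · intro h
    have adjacent : ∀ i j : Fin (N - 1), j.val = i.val + 1 →
        R i j * A j j + R j i * A i i ≥ 2 * A i j := by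
      intro i j hij
      have hc := h (i.val + 2) (by omega) (by omega)
      simp only [show i.val + 2 + 1 = i.val + 3 from rfl,
        show i.val + 2 - 1 = i.val + 1 from rfl] at hc
      rw [(hRsub i j hij).1, (hRsub i j hij).2, (hAsub i j hij).1, hAdiag i, hAdiag j, hij]
      simp only [show i.val + 1 + 1 = i.val + 2 from rfl, show i.val + 1 + 2 = i.val + 3 from rfl]
      linarith
    intro i j
    by_cases hij : j.val = i.val + 1
    · exact adjacent i j hij
    by_cases hji : i.val = j.val + 1
    · have := adjacent j i hji
      rw [(hAsub j i hji).1] at this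
      rw [(hAsub j i hji).2]
      linarith
    by_cases heq : i = j
    · subst heq
      rw [hRdiag]
      linarith
    have hne : i.val ≠ j.val := fun e => heq (Fin.ext e)
    rw [hRzero i j (by omega), hRzero j i (by omega), hAzero i j (by omega)]
    simp
end

section
/- Let S be a topological space equipped with its Borel σ-algebra, and let (μ_z)_{z ∈ S} be a family of Borel probability measures on S such that μ_z(U) > 0 for every z ∈ S and every nonempty open set U ⊆ S. Let f : S → ℝ be continuous with 0 ≤ f(z) ≤ 1 for all z, and suppose ∫_S f(y) μ_z(dy) ≤ f(z) for every z ∈ S. If f(z₀) > 0 for some z₀ ∈ S, then f(z) > 0 for every z ∈ S. -/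
open MeasureTheory

/-- Abstract core of independence of the starting point: if each transition kernel `μ z`
is a Borel probability measure charging every nonempty open set, and `f : S → ℝ` is a
continuous function with `0 ≤ f ≤ 1` which is superharmonic for the kernel
(`∫ f dμ_z ≤ f z`), then positivity of `f` at one point implies positivity everywhere. -/
theorem stmt_13 {S : Type*} [TopologicalSpace S] [MeasurableSpace S] [BorelSpace S]
    (μ : S → Measure S) [∀ z, IsProbabilityMeasure (μ z)]
    (hμ : ∀ z : S, ∀ U : Set S, IsOpen U → U.Nonempty → 0 < μ z U)
    (f : S → ℝ) (hf : Continuous f) (hf0 : ∀ z, 0 ≤ f z) (hf1 : ∀ z, f z ≤ 1)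
    (hsuper : ∀ z, ∫ y, f y ∂(μ z) ≤ f z)
    (z₀ : S) (hz₀ : 0 < f z₀) :
    ∀ z, 0 < f z := by
  intro z
  have hint : Integrable f (μ z) :=
    Integrable.of_bound hf.measurable.aestronglyMeasurable 1
      (Filter.Eventually.of_forall fun y => by
        rw [Real.norm_of_nonneg (hf0 y)]
        exact hf1 y)
  exact ((integral_pos_iff_support_of_nonneg hf0 hint).2
    (hμ z _ hf.isOpen_support ⟨z₀, hz₀.ne'⟩)).trans_le (hsuper z)
end

section
/- Let N ≥ 2 and let q⁻_1, q⁺_1, …, q⁻_N, q⁺_N be real numbers with 0 < q^±_k < 1 for all k and q⁺_{k+1} + q⁻_k = 1 for k = 1,…,N−1. Define the (N−1)×(N−1) real matrix R by: R_{kk} = 1, R_{k,k+1} = −q⁻_{k+1}, R_{k+1,k} = −q⁺_{k+1}, and R_{kl} = 0 for |k−l| ≥ 2 (indices k, l ∈ {1,…,N−1}). Then R is a nonsingular M-matrix: R is a Z-matrix (all off-diagonal entries are ≤ 0), and for every nonempty subset I ⊆ {1,…,N−1} the principal submatrix [R]_I is an S-matrix (there exists a vector u with all entries > 0 such that all entries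 of [R]_I u are > 0). -/
open Matrix

/-- A constant summed over the indices in `I` with value `m` contributes at most once. -/
lemma sum_ite_val_eq_le {n : ℕ} (I : Finset (Fin n)) (m : ℕ) {c : ℝ} (hc : 0 ≤ c) :
    ∑ j ∈ I, (if j.val = m then c else 0) ≤ c := by
  by_cases h : ∃ i ∈ I, i.val = m
  · obtain ⟨i, hi, rfl⟩ := h
    simp [← Fin.ext_iff, hi]
  · push Not at h
    rw [Finset.sum_eq_zero fun j hj => if_neg (h j hj)]
    exact hc

/-- A strictly superharmonic positive vector for the gap reflection matrix: the reversible
measure of the associated birth-death chain times a strictly concave profile. -/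
lemma exists_strict_superharmonic (N : ℕ) (qm qp : ℕ → ℝ)
    (hm : ∀ k, 1 ≤ k → k ≤ N → 0 < qm k) (hp : ∀ k, 1 ≤ k → k ≤ N → 0 < qp k)
    (hsum : ∀ k, 1 ≤ k → k ≤ N - 1 → qp (k + 1) + qm k = 1) :
    ∃ v : ℕ → ℝ, v 0 = 0 ∧ (∀ k, k < N → 0 < v (k + 1)) ∧
      ∀ k, k + 1 < N → qp (k + 1) * v k + qm (k + 2) * v (k + 2) < v (k + 1) := by
  set w : ℕ → ℝ := fun k => ∏ j ∈ Finset.range k, qp (j + 1) / qm (j + 1) with hw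
  set d : ℕ → ℝ := fun k => ∏ j ∈ Finset.range k, qm (j + 1) / (2 * qp (j + 2)) with hd
  set h : ℕ → ℝ := fun k => ∑ j ∈ Finset.range k, d j with hh
  have wpos : ∀ k, k ≤ N → 0 < w k := fun k hk => Finset.prod_pos fun j hj => by
    have := Finset.mem_range.1 hj
    exact div_pos (hp _ (by omega) (by omega)) (hm _ (by omega) (by omega))
  have dpos : ∀ k, k < N → 0 < d k := fun k hk => Finset.prod_pos fun j hj => by
    have := Finset.mem_range.1 hj
    exact div_pos (hm _ (by omega) (by omega))
      (mul_pos two_pos (hp _ (by omega) (by omega)))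
  have wsucc : ∀ k, k < N → qm (k + 1) * w (k + 1) = qp (k + 1) * w k := fun k hk => by
    have := (hm (k + 1) (by omega) (by omega)).ne'
    simp only [hw, Finset.prod_range_succ]
    field_simp
  have dsucc : ∀ k, k + 1 < N → 2 * (qp (k + 2) * d (k + 1)) = qm (k + 1) * d k :=
    fun k hk => by
      have := (hp (k + 2) (by omega) (by omega)).ne'
      simp only [hd, Finset.prod_range_succ]
      field_simp
  have hsucc : ∀ k, h (k + 1) = h k + d k := fun k => Finset.sum_range_succ _ _
  refine ⟨fun k => w k * h k, by simp [hh], fun k hk => mul_pos (wpos _ (by omega)) ?_,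
    fun k hk => ?_⟩
  · refine Finset.sum_pos (fun j hj => dpos j ?_) ⟨0, by simp⟩
    have := Finset.mem_range.1 hj
    omega
  · have hqm : qm (k + 1) = 1 - qp (k + 2) := by
      linarith [hsum (k + 1) (by omega) (by omega)]
    have key : 0 < w (k + 1) * (qm (k + 1) * d k) := mul_pos (wpos _ (by omega))
      (mul_pos (hm _ (by omega) (by omega)) (dpos _ (by omega)))
    have drop : w (k + 1) * h (k + 1) - (qp (k + 1) * (w k * h k) +
        qm (k + 2) * (w (k + 2) * h (k + 2))) = w (k + 1) * (qm (k + 1) * d k) / 2 := by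
      have h1 := wsucc k (by omega)
      have h2 : qm (k + 2) * w (k + 2) = qp (k + 2) * w (k + 1) := wsucc (k + 1) hk
      have h3 := dsucc k hk
      have h4 : h (k + 2) = h (k + 1) + d (k + 1) := hsucc (k + 1)
      rw [← mul_assoc, ← mul_assoc, h2, ← h1, h4, hsucc k]
      rw [hqm] at h3 ⊢
      linear_combination (-w (k + 1) / 2) * h3
    linarith

/-- The reflection matrix `R` of the gap process of a system of `N` competing Brownian
particles with asymmetric collisions is a nonsingular M-matrix: it is a Z-matrix and every
principal submatrix is an S-matrix. Here matrix indices `i : Fin (N-1)` correspond to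
the 1-based index `i.val + 1`. -/
theorem stmt_15 (N : ℕ) (hN : 2 ≤ N)
    (qm qp : ℕ → ℝ)
    (hq : ∀ k, 1 ≤ k → k ≤ N → 0 < qm k ∧ qm k < 1 ∧ 0 < qp k ∧ qp k < 1)
    (hsum : ∀ k, 1 ≤ k → k ≤ N - 1 → qp (k + 1) + qm k = 1)
    (R : Matrix (Fin (N - 1)) (Fin (N - 1)) ℝ)
    (hRdiag : ∀ k, R k k = 1)
    (hRsub : ∀ k l : Fin (N - 1), l.val = k.val + 1 →
      R k l = - qm (k.val + 2) ∧ R l k = - qp (k.val + 2))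
    (hRzero : ∀ k l : Fin (N - 1), k.val + 2 ≤ l.val ∨ l.val + 2 ≤ k.val → R k l = 0) :
    (∀ i j : Fin (N - 1), i ≠ j → R i j ≤ 0) ∧
    (∀ I : Finset (Fin (N - 1)), I.Nonempty →
      ∃ u : Fin (N - 1) → ℝ, (∀ i ∈ I, 0 < u i) ∧ (∀ i ∈ I, 0 < ∑ j ∈ I, R i j * u j)) := by
  have hm : ∀ k, 1 ≤ k → k ≤ N → 0 < qm k := fun k h1 h2 => (hq k h1 h2).1
  have hp : ∀ k, 1 ≤ k → k ≤ N → 0 < qp k := fun k h1 h2 => (hq k h1 h2).2.2.1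
  refine ⟨fun i j hij => ?_, fun I _ => ?_⟩
  · have hne : i.val ≠ j.val := fun h => hij (Fin.ext h)
    rcases (by omega : j.val = i.val + 1 ∨ i.val = j.val + 1 ∨
      (i.val + 2 ≤ j.val ∨ j.val + 2 ≤ i.val)) with h | h | h
    · rw [(hRsub i j h).1]
      linarith [hm (i.val + 2) (by omega) (by omega)]
    · rw [(hRsub j i h).2]
      linarith [hp (j.val + 2) (by omega) (by omega)]
    · exact (hRzero i j h).le
  · obtain ⟨v, v0, vpos, hv⟩ := exists_strict_superharmonic N qm qp hm hp hsum
    refine ⟨fun j => v (j.val + 1), fun i _ => vpos _ (by omega), fun i hi => ?_⟩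
    have hvi : 0 ≤ v i.val := by
      rcases Nat.eq_zero_or_eq_succ_pred i.val with h | h
      · rw [h, v0]
      · rw [h]
        exact (vpos _ (by have := i.isLt; omega)).le
    have hcp : 0 ≤ qp (i.val + 1) * v i.val :=
      mul_nonneg (hp _ (by omega) (by omega)).le hvi
    have hcm : 0 ≤ qm (i.val + 2) * v (i.val + 2) :=
      mul_nonneg (hm _ (by omega) (by omega)).le (vpos (i.val + 1) (by omega)).le
    have entry : ∀ j ∈ I, R i j * v (j.val + 1) = (if i = j then v (i.val + 1) else 0)
        - (if j.val = i.val - 1 then if i.val = 0 then 0 else qp (i.val + 1) * v i.val else 0)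
        - (if j.val = i.val + 1 then qm (i.val + 2) * v (i.val + 2) else 0) := by
      intro j _
      by_cases hij : i = j
      · subst hij
        rw [hRdiag, if_pos rfl, if_neg (by omega : ¬ i.val = i.val + 1)]
        split_ifs <;> first | omega | ring
      have hne : i.val ≠ j.val := fun h => hij (Fin.ext h)
      rcases (by omega : j.val = i.val + 1 ∨ i.val = j.val + 1 ∨
        (i.val + 2 ≤ j.val ∨ j.val + 2 ≤ i.val)) with h | h | h
      · rw [(hRsub i j h).1, if_neg hij, if_neg (by omega), if_pos h, h]
        ring
      · rw [(hRsub j i h).2, if_neg hij, if_pos (by omega), if_neg (by omega),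
          if_neg (by omega), h]
        ring
      · rw [hRzero i j h, if_neg hij, if_neg (by omega), if_neg (by omega)]
        ring
    rw [Finset.sum_congr rfl entry, Finset.sum_sub_distrib, Finset.sum_sub_distrib,
      Finset.sum_ite_eq, if_pos hi]
    have hlow := sum_ite_val_eq_le I (i.val - 1)
      (c := if i.val = 0 then 0 else qp (i.val + 1) * v i.val) (by split_ifs <;> simp [hcp])
    have hlow' : (if i.val = 0 then 0 else qp (i.val + 1) * v i.val)
        ≤ qp (i.val + 1) * v i.val := by
      split_ifs <;> simp [hcp]
    linarith [sum_ite_val_eq_le I (i.val + 1) hcm, hv i.val (by omega)]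
end
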